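/- arXiv:1211.2696 — 4 statements merged into one kernel-verified Lean document; each statement's English description precedes it below -/
import Mathlib

section
/- For every ε with 0 < ε < 1/4 there exists β₀ ≥ 0 such that for every β ≥ β₀ there exists a family of potential functions Φ_n : {0,1}^n → ℝ (one for each n ≥ 1), defining for each n an n-player potential game in which every player has the two strategies 0 and 1, whose logit dynamics transition matrix at rationality level β is P_n, such that the logit dynamics for this family is not asymptotically metastable with tolerance ε; that is, for every n₀ ∈ ℕ, every function p of at most polynomial growth, and every super-polynomial function q, there exist n ≥ n₀ and a profile x ∈ {0,1}^n such that for every probability distribution μ on {0,1}^n that is (ε, ⌈q(n)⌉)-metastable for P_n, and for every t ∈ ℕ with t ≤ p(n), ‖P_n^t(x,·) − μ‖_TV > ε. -/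
open Finset Matrix

/-- Total variation distance between two functions (distributions) on a finite set. -/
noncomputable def tvDist {S : Type*} [Fintype S] (μ ν : S → ℝ) : ℝ :=
  (1 / 2) * ∑ x, |μ x - ν x|

/-- A probability distribution on a finite set. -/
def IsProbDist {S : Type*} [Fintype S] (μ : S → ℝ) : Prop :=
  (∀ x, 0 ≤ μ x) ∧ ∑ x, μ x = 1

/-- A (row-)stochastic matrix. -/
def IsStochastic {S : Type*} [Fintype S] (P : Matrix S S ℝ) : Prop :=
  (∀ x y, 0 ≤ P x y) ∧ ∀ x, ∑ y, P x y = 1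

/-- Reversibility of `P` with respect to `π`. -/
def Reversible {S : Type*} [Fintype S] (P : Matrix S S ℝ) (π : S → ℝ) : Prop :=
  ∀ x y, π x * P x y = π y * P y x

/-- `μ` is `(ε, T)`-metastable for `P`. -/
def IsMetastable {S : Type*} [Fintype S] [DecidableEq S]
    (P : Matrix S S ℝ) (μ : S → ℝ) (ε : ℝ) (T : ℕ) : Prop :=
  ∀ t : ℕ, t ≤ T → tvDist (μ ᵥ* (P ^ t)) μ ≤ ε

/-- The killed restriction `P_{\bar L}` of `P` to `L`, as a matrix on the full space. -/
noncomputable def Matrix.killed {S : Type*} [Fintype S] [DecidableEq S]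
    (P : Matrix S S ℝ) (L : Finset S) : Matrix S S ℝ :=
  fun x y => if x ∈ L ∧ y ∈ L then P x y else 0

/-- The restricted chain `P̊_L` on `L`. -/
noncomputable def restChain {S : Type*} [Fintype S] [DecidableEq S]
    (P : Matrix S S ℝ) (L : Finset S) : Matrix L L ℝ :=
  fun x y => if (x : S) = (y : S) then P (x : S) (x : S) + ∑ z ∈ Lᶜ, P (x : S) z
             else P (x : S) (y : S)

/-- The bottleneck ratio `B(L)` of `L` with respect to `P` and `π`. -/
noncomputable def bottleneck {S : Type*} [Fintype S] [DecidableEq S]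
    (P : Matrix S S ℝ) (π : S → ℝ) (L : Finset S) : ℝ :=
  (∑ x ∈ L, ∑ y ∈ Lᶜ, π x * P x y) / ∑ x ∈ L, π x

/-- The Gibbs measure associated to a potential `Φ` at rationality level `β`. -/
noncomputable def gibbs {S : Type*} [Fintype S] (β : ℝ) (Φ : S → ℝ) (x : S) : ℝ :=
  Real.exp (-β * Φ x) / ∑ y, Real.exp (-β * Φ y)

/-- The logit update probability `σ_i(s | x_{−i})`. -/
noncomputable def logitσ {n : ℕ} {Sty : Fin n → Type*} [∀ i, Fintype (Sty i)]
    [∀ i, DecidableEq (Sty i)]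
    (u : ∀ i : Fin n, (∀ j, Sty j) → ℝ) (β : ℝ) (i : Fin n)
    (x : ∀ j, Sty j) (s : Sty i) : ℝ :=
  Real.exp (β * u i (Function.update x i s)) /
    ∑ z : Sty i, Real.exp (β * u i (Function.update x i z))

/-- The logit dynamics transition matrix for an `n`-player game with utilities `u`
at rationality level `β`. -/
noncomputable def logitP (n : ℕ) (Sty : Fin n → Type*) [∀ i, Fintype (Sty i)]
    [∀ i, DecidableEq (Sty i)]
    (u : ∀ i : Fin n, (∀ j, Sty j) → ℝ) (β : ℝ) :
    Matrix (∀ j, Sty j) (∀ j, Sty j) ℝ :=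
  fun x y =>
    if x = y then (n : ℝ)⁻¹ * ∑ i, logitσ u β i x (x i)
    else if (Finset.univ.filter fun i => x i ≠ y i).card = 1 then
      (n : ℝ)⁻¹ * ∑ i ∈ Finset.univ.filter fun i => x i ≠ y i, logitσ u β i x (y i)
    else 0

/-- The logit dynamics transition matrix for an `n`-player potential game with
potential `Φ` at rationality level `β` (i.e. `σ_i` uses `exp(−β·Φ)`). -/
noncomputable def logitPpot (n : ℕ) (Sty : Fin n → Type*) [∀ i, Fintype (Sty i)]
    [∀ i, DecidableEq (Sty i)]
    (Φ : (∀ j, Sty j) → ℝ) (β : ℝ) :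
    Matrix (∀ j, Sty j) (∀ j, Sty j) ℝ :=
  logitP n Sty (fun _ x => -Φ x) β

/-- `p` has at most polynomial growth. -/
def PolyGrowth (p : ℕ → ℝ) : Prop :=
  ∃ C : ℝ, ∃ k : ℕ, ∀ n : ℕ, 0 ≤ p n ∧ p n ≤ C * ((n : ℝ) + 1) ^ k

/-- `q` is super-polynomial. -/
def SuperPoly (q : ℕ → ℝ) : Prop :=
  (∀ n, 0 < q n) ∧
    ∀ k : ℕ, Filter.Tendsto (fun n : ℕ => (n : ℝ) ^ k / q n) Filter.atTop (nhds 0)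

section Averages

variable {S : Type*} [Fintype S]

/-- A test function with values in `[0, 1]` has expectations differing by at most the total
variation distance. -/
lemma dotProduct_sub_le_tvDist {μ ν g : S → ℝ} (hsum : ∑ x, μ x = ∑ x, ν x)
    (h0 : ∀ x, 0 ≤ g x) (h1 : ∀ x, g x ≤ 1) : μ ⬝ᵥ g - ν ⬝ᵥ g ≤ tvDist μ ν := by
  have key : μ ⬝ᵥ g - ν ⬝ᵥ g = ∑ x, (μ x - ν x) * (g x - 1 / 2) := by
    simp only [dotProduct, mul_sub, sub_mul, Finset.sum_sub_distrib, ← Finset.sum_mul, hsum]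
    ring
  rw [key, tvDist, Finset.mul_sum]
  refine Finset.sum_le_sum fun x _ => ?_
  calc (μ x - ν x) * (g x - 1 / 2) ≤ |μ x - ν x| * |g x - 1 / 2| := by
        rw [← abs_mul]; exact le_abs_self _
    _ ≤ |μ x - ν x| * (1 / 2) := by
        gcongr
        rw [abs_le]; constructor <;> linarith [h0 x, h1 x]
    _ = 1 / 2 * |μ x - ν x| := by ring

lemma tvDist_comm (μ ν : S → ℝ) : tvDist μ ν = tvDist ν μ := by
  simp only [tvDist, abs_sub_comm]

variable {P : Matrix S S ℝ}

lemma IsStochastic.mulVec_const (hP : IsStochastic P) (c : ℝ) :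
    P *ᵥ (fun _ => c) = fun _ => c := by
  ext x
  simp [Matrix.mulVec, dotProduct, ← Finset.sum_mul, hP.2 x]

lemma IsStochastic.mulVec_mono (hP : IsStochastic P) {f g : S → ℝ} (h : ∀ x, f x ≤ g x) (x : S) :
    (P *ᵥ f) x ≤ (P *ᵥ g) x :=
  Finset.sum_le_sum fun y _ => mul_le_mul_of_nonneg_left (h y) (hP.1 x y)

variable [DecidableEq S]

lemma IsStochastic.pow_mulVec_const (hP : IsStochastic P) (c : ℝ) (t : ℕ) :
    (P ^ t) *ᵥ (fun _ => c) = fun _ => c := by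
  induction t with
  | zero => simp
  | succ t ih => rw [pow_succ, ← Matrix.mulVec_mulVec, hP.mulVec_const, ih]

lemma IsStochastic.sum_pow_apply (hP : IsStochastic P) (t : ℕ) (x : S) :
    ∑ y, (P ^ t) x y = 1 := by
  simpa [Matrix.mulVec, dotProduct] using congrFun (hP.pow_mulVec_const 1 t) x

lemma IsStochastic.sum_vecMul_pow (hP : IsStochastic P) (μ : S → ℝ) (t : ℕ) :
    ∑ y, (μ ᵥ* P ^ t) y = ∑ y, μ y := by
  have h := Matrix.dotProduct_mulVec μ (P ^ t) (fun _ => (1 : ℝ))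
  rw [hP.pow_mulVec_const] at h
  simpa [dotProduct] using h.symm

/-- A function contracted in expectation up to an additive error, here `r * c`, decays
geometrically down to the level `c`. -/
lemma IsStochastic.pow_mulVec_le_of_drift (hP : IsStochastic P) {f : S → ℝ} {r c : ℝ}
    (hr : r ≤ 1) (hf : ∀ x, (P *ᵥ f) x ≤ (1 - r) * f x + r * c) (t : ℕ) (x : S) :
    ((P ^ t) *ᵥ f) x ≤ (1 - r) ^ t * (f x - c) + c := by
  induction t generalizing x with
  | zero => simp
  | succ t ih =>
    rw [pow_succ', ← Matrix.mulVec_mulVec]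
    refine (hP.mulVec_mono ih x).trans ?_
    have e : (fun y => (1 - r) ^ t * (f y - c) + c)
        = (1 - r) ^ t • f + fun _ => (c - (1 - r) ^ t * c) := by
      ext y; simp only [Pi.add_apply, Pi.smul_apply, smul_eq_mul]; ring
    rw [show (P *ᵥ fun y => (1 - r) ^ t * (f y - c) + c) x
        = (1 - r) ^ t * (P *ᵥ f) x + (c - (1 - r) ^ t * c) by
      rw [e, Matrix.mulVec_add, Matrix.mulVec_smul, hP.mulVec_const]; rfl]
    have := mul_le_mul_of_nonneg_left (hf x) (pow_nonneg (sub_nonneg.2 hr) t)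
    rw [pow_succ]
    linarith

/-- A function that increases in expectation by at most `c` per step increases by at most `t * c`
in `t` steps. -/
lemma IsStochastic.pow_mulVec_le_add (hP : IsStochastic P) {f : S → ℝ} {c : ℝ}
    (hf : ∀ x, (P *ᵥ f) x ≤ f x + c) (t : ℕ) (x : S) :
    ((P ^ t) *ᵥ f) x ≤ f x + t * c := by
  induction t generalizing x with
  | zero => simp
  | succ t ih =>
    rw [pow_succ', ← Matrix.mulVec_mulVec]
    refine (hP.mulVec_mono ih x).trans ?_
    rw [show (P *ᵥ fun y => f y + t * c) x = (P *ᵥ f) x + t * c by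
      rw [show (fun y => f y + t * c) = f + fun _ => t * c from rfl, Matrix.mulVec_add,
        hP.mulVec_const]; rfl]
    push_cast
    linarith [hf x]

end Averages

section Logit

variable {n : ℕ} {Sty : Fin n → Type*} [∀ i, Fintype (Sty i)] [∀ i, DecidableEq (Sty i)]

lemma logitP_apply_eq_sum (u : ∀ i : Fin n, (∀ j, Sty j) → ℝ) (β : ℝ) (x y : ∀ j, Sty j) :
    logitP n Sty u β x y =
      (n : ℝ)⁻¹ * ∑ i, ∑ s, logitσ u β i x s * if Function.update x i s = y then 1 else 0 := by
  have upd (i : Fin n) (s : Sty i) : Function.update x i s = y ↔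
      s = y i ∧ ∀ j, j ≠ i → x j = y j := by
    rw [Function.update_eq_iff]
  have inner (i : Fin n) : (∑ s, logitσ u β i x s * if Function.update x i s = y then 1 else 0)
      = if ∀ j, j ≠ i → x j = y j then logitσ u β i x (y i) else 0 := by
    simp only [upd]
    by_cases h : ∀ j, j ≠ i → x j = y j
    · rw [if_pos h]
      simp only [and_iff_left h, mul_ite, mul_one, mul_zero, Finset.sum_ite_eq',
        Finset.mem_univ, if_true]
    · rw [if_neg h]
      exact Finset.sum_eq_zero fun s _ => by rw [if_neg fun hs => h hs.2, mul_zero]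
  simp only [inner]
  unfold logitP
  split_ifs with h1 h2
  · subst h1; simp
  · congr 1
    obtain ⟨i, hi⟩ := Finset.card_eq_one.1 h2
    have hmem (j : Fin n) : x j ≠ y j ↔ j = i := by
      simpa using congrArg (fun s => j ∈ s) hi
    rw [hi, Finset.sum_singleton, Finset.sum_eq_single i]
    · rw [if_pos]
      intro j hj
      by_contra hne
      exact hj ((hmem j).1 hne)
    · intro j _ hj
      rw [if_neg]
      intro h
      exact (hmem i).2 rfl (h i hj.symm)
    · simp
  · rw [Finset.sum_eq_zero, mul_zero]
    intro i _
    rw [if_neg]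
    intro h
    apply h2
    rw [Finset.card_eq_one]
    refine ⟨i, ?_⟩
    ext j
    simp only [Finset.mem_filter, Finset.mem_univ, true_and, Finset.mem_singleton]
    constructor
    · intro hj
      by_contra hne
      exact hj (h j hne)
    · rintro rfl hj
      apply h1
      ext l
      by_cases hl : l = j
      · subst hl; exact hj
      · exact h l hl

lemma logitP_mulVec (u : ∀ i : Fin n, (∀ j, Sty j) → ℝ) (β : ℝ) (f : (∀ j, Sty j) → ℝ)
    (x : ∀ j, Sty j) :
    (logitP n Sty u β *ᵥ f) x =
      (n : ℝ)⁻¹ * ∑ i, ∑ s, logitσ u β i x s * f (Function.update x i s) := by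
  simp only [Matrix.mulVec, dotProduct, logitP_apply_eq_sum, mul_assoc, Finset.sum_mul]
  rw [← Finset.mul_sum, Finset.sum_comm]
  congr 1
  refine Finset.sum_congr rfl fun i _ => ?_
  rw [Finset.sum_comm]
  refine Finset.sum_congr rfl fun s _ => ?_
  rw [← Finset.mul_sum]
  simp

lemma sum_logitσ (u : ∀ i : Fin n, (∀ j, Sty j) → ℝ) (β : ℝ) (i : Fin n) (x : ∀ j, Sty j) :
    ∑ s, logitσ u β i x s = 1 := by
  unfold logitσ
  rw [← Finset.sum_div]
  have : Nonempty (Sty i) := ⟨x i⟩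
  exact div_self (Finset.sum_pos (fun _ _ => Real.exp_pos _) Finset.univ_nonempty).ne'

lemma isStochastic_logitP (hn : n ≠ 0) (u : ∀ i : Fin n, (∀ j, Sty j) → ℝ) (β : ℝ) :
    IsStochastic (logitP n Sty u β) := by
  constructor
  · intro x y
    rw [logitP_apply_eq_sum]
    refine mul_nonneg (by positivity) (Finset.sum_nonneg fun i _ => Finset.sum_nonneg fun s _ => ?_)
    unfold logitσ
    split_ifs <;> positivity
  · intro x
    have h := logitP_mulVec u β (fun _ => 1) x
    simp only [mul_one, sum_logitσ] at h
    simpa [Matrix.mulVec, dotProduct, hn] using h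

end Logit

/-- Gibbs weights of a two-player landscape with a metastable well at `(0, 0)`, a barrier of
weight `h`, and a deep well at `(1, 1)`. -/
noncomputable def doubleWellWeight (h : ℝ) : Bool → Bool → ℝ
  | false, false => 1
  | true, true => 240
  | _, _ => h

lemma doubleWellWeight_pos {h : ℝ} (hh : 0 < h) (a b : Bool) : 0 < doubleWellWeight h a b := by
  cases a <;> cases b <;> simp [doubleWellWeight, hh]

/-- When the Gibbs weights depend on two players `i` and `j` only, so does the dynamics of
functions of the strategies of `i` and `j`. -/
lemma logitPpot_mulVec_of_two {n : ℕ} {i j : Fin n} (hij : i ≠ j) {β : ℝ} (hβ : β ≠ 0)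
    {w : Bool → Bool → ℝ} (hw : ∀ a b, 0 < w a b) (F : Bool → Bool → ℝ) (x : Fin n → Bool) :
    (logitPpot n (fun _ => Bool) (fun y => -Real.log (w (y i) (y j)) / β) β *ᵥ
      fun y => F (y i) (y j)) x =
    F (x i) (x j) + (n : ℝ)⁻¹ *
      (((∑ s, w s (x j) * F s (x j)) / (∑ s, w s (x j)) - F (x i) (x j)) +
        ((∑ s, w (x i) s * F (x i) s) / (∑ s, w (x i) s) - F (x i) (x j))) := by
  have hexp (a b : Bool) : Real.exp (β * -(-Real.log (w a b) / β)) = w a b := by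
    rw [show β * -(-Real.log (w a b) / β) = Real.log (w a b) by field_simp]
    exact Real.exp_log (hw _ _)
  have hn : (n : ℝ) ≠ 0 := by
    have := i.pos
    positivity
  unfold logitPpot
  rw [logitP_mulVec]
  set u : Fin n → (Fin n → Bool) → ℝ := fun _ y => -(-Real.log (w (y i) (y j)) / β) with hu
  have hrest : ∀ l ∈ (Finset.univ : Finset (Fin n)), l ∉ ({i, j} : Finset (Fin n)) →
      (∑ s, logitσ u β l x s * F (Function.update x l s i) (Function.update x l s j))
        - F (x i) (x j) = 0 := by
    intro l _ hl
    simp only [Finset.mem_insert, Finset.mem_singleton, not_or] at hl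
    have e (s : Bool) : logitσ u β l x s *
        F (Function.update x l s i) (Function.update x l s j)
        = logitσ u β l x s * F (x i) (x j) := by
      rw [Function.update_of_ne (Ne.symm hl.1), Function.update_of_ne (Ne.symm hl.2)]
    simp only [e]
    rw [← Finset.sum_mul, sum_logitσ (Sty := fun _ => Bool) u β l x, one_mul, sub_self]
  have hsum := Finset.sum_subset (Finset.subset_univ ({i, j} : Finset (Fin n))) hrest
  rw [Finset.sum_pair hij, Finset.sum_sub_distrib, Finset.sum_const, Finset.card_univ,
    Fintype.card_fin, nsmul_eq_mul] at hsum
  have hi (s : Bool) : logitσ u β i x s = w s (x j) / ∑ z, w z (x j) := by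
    simp only [logitσ, hu, hexp, Function.update_self, Function.update_of_ne hij.symm]
  have hj (s : Bool) : logitσ u β j x s = w (x i) s / ∑ z, w (x i) z := by
    simp only [logitσ, hu, hexp, Function.update_self, Function.update_of_ne hij]
  simp only [hi, hj, Function.update_self, Function.update_of_ne hij.symm,
    Function.update_of_ne hij, div_mul_eq_mul_div, ← Finset.sum_div] at hsum
  rw [hsum]
  field_simp
  ring

section DoubleWell

variable {n : ℕ} {i j : Fin n} {β h : ℝ}

/-- The potential with Gibbs weights `doubleWellWeight h` in the strategies of `i` and `j`. -/
noncomputable def doubleWellPotential (i j : Fin n) (β h : ℝ) (x : Fin n → Bool) : ℝ :=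
  -Real.log (doubleWellWeight h (x i) (x j)) / β

/-- Lyapunov function for the drift towards the deep well. -/
def deepWellLyapunov : Bool → Bool → ℝ
  | false, false => 4
  | true, true => 0
  | _, _ => 3

lemma doubleWell_lyapunov_drift (hij : i ≠ j) (hβ : β ≠ 0) (h0 : 0 < h) (h1 : h ≤ 1)
    (x : Fin n → Bool) :
    (logitPpot n (fun _ => Bool) (doubleWellPotential i j β h) β *ᵥ
      fun y => deepWellLyapunov (y i) (y j)) x ≤
    (1 - h / (4 * n)) * deepWellLyapunov (x i) (x j) + h / (4 * n) * (1 / 10) := by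
  have hn : (0 : ℝ) < n := by exact_mod_cast i.pos
  have key := logitPpot_mulVec_of_two hij hβ (doubleWellWeight_pos h0) deepWellLyapunov x
  unfold doubleWellPotential
  rw [key]
  have e (a : ℝ) : (1 - h / (4 * n)) * a + h / (4 * n) * (1 / 10)
      = a + (n : ℝ)⁻¹ * (h / 4 * (1 / 10 - a)) := by field_simp; ring
  rw [e]
  gcongr
  have hd1 : 0 < h + 1 := by linarith
  have hd2 : 0 < 240 + h := by linarith
  cases x i <;> cases x j <;>
    simp only [doubleWellWeight, deepWellLyapunov, Fintype.sum_bool] <;>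
    rw [div_sub' (by positivity), div_sub' (by positivity), div_add_div _ _ (by positivity)
      (by positivity), div_le_iff₀ (by positivity)] <;>
    nlinarith [mul_pos h0 h0, mul_pos h0 (mul_pos h0 h0), mul_nonneg h0.le (sub_nonneg.2 h1),
      mul_nonneg (mul_pos h0 h0).le (sub_nonneg.2 h1)]

lemma doubleWell_escape_drift (hij : i ≠ j) (hβ : β ≠ 0) (h0 : 0 < h)
    (x : Fin n → Bool) :
    (logitPpot n (fun _ => Bool) (doubleWellPotential i j β h) β *ᵥ
      fun y => if y i || y j then 1 else 0) x ≤
    (if x i || x j then 1 else 0) + 2 * h / n := by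
  have hn : (0 : ℝ) < n := by exact_mod_cast i.pos
  have key := logitPpot_mulVec_of_two hij hβ (doubleWellWeight_pos h0)
    (fun a b => if a || b then (1 : ℝ) else 0) x
  unfold doubleWellPotential
  rw [key, show 2 * h / n = (n : ℝ)⁻¹ * (2 * h) by field_simp]
  gcongr
  have hbarrier : h / (h + 1) ≤ h := div_le_self h0.le (by linarith)
  have hdeep : (240 + h) / (240 + h) = 1 := div_self (by positivity)
  cases x i <;> cases x j <;>
    simp [doubleWellWeight] <;>
    linarith

/-- If the time scale `n / h` of leaving the metastable well lies well between `s` and `T`, then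
the dynamics started in the metastable well is at time `s` far from every distribution that is
metastable up to time `T`. -/
lemma doubleWell_far_from_metastable (hij : i ≠ j) (hβ : β ≠ 0) (h0 : 0 < h) (h1 : h ≤ 1)
    {ε : ℝ} (hε : ε < 1 / 4) {s T : ℕ} (hs : s * (2 * h / n) ≤ 1 / 4)
    (hT : 40 ≤ T * (h / (4 * n))) {μ : (Fin n → Bool) → ℝ} (hμ : IsProbDist μ)
    (hmeta : IsMetastable (logitPpot n (fun _ => Bool) (doubleWellPotential i j β h) β) μ ε T) :
    ε < tvDist ((logitPpot n (fun _ => Bool) (doubleWellPotential i j β h) β ^ s)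
      fun _ => false) μ := by
  have hn : (0 : ℝ) < n := by exact_mod_cast i.pos
  have hn1 : (1 : ℝ) ≤ n := by exact_mod_cast i.pos
  have drift := doubleWell_lyapunov_drift hij hβ h0 h1
  have escape := doubleWell_escape_drift hij hβ h0
  have hP : IsStochastic (logitPpot n (fun _ => Bool) (doubleWellPotential i j β h) β) :=
    isStochastic_logitP i.pos.ne' _ β
  generalize logitPpot n (fun _ => Bool) (doubleWellPotential i j β h) β = P at *
  set r : ℝ := h / (4 * n) with hr
  have hr0 : 0 < r := by positivity
  have hr1 : r ≤ 1 := by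
    rw [hr, div_le_one (by positivity)]; linarith
  have hpow : (1 - r) ^ T ≤ 1 / 40 := by
    have hpos : (0 : ℝ) < 1 + T * r := by linarith
    calc (1 - r) ^ T ≤ Real.exp (-r) ^ T := by
          have := sub_nonneg.2 hr1
          gcongr
          linarith [Real.add_one_le_exp (-r)]
      _ = (Real.exp (T * r))⁻¹ := by
          rw [← Real.exp_nat_mul, ← Real.exp_neg]; ring_nf
      _ ≤ (1 / 40 : ℝ) := by
          rw [one_div]
          gcongr
          linarith [Real.add_one_le_exp (T * r)]
  set f : (Fin n → Bool) → ℝ := fun y => deepWellLyapunov (y i) (y j) with hf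
  set g : (Fin n → Bool) → ℝ := fun y => if y i && y j then 1 else 0 with hg
  have hg0 (y) : 0 ≤ g y := by simp only [hg]; split_ifs <;> norm_num
  have hg1 (y) : g y ≤ 1 := by simp only [hg]; split_ifs <;> norm_num
  have hlow (y) : (P ^ T *ᵥ f) y ≤ 1 / 5 := by
    refine (hP.pow_mulVec_le_of_drift hr1 drift T y).trans ?_
    have h4 : deepWellLyapunov (y i) (y j) ≤ 4 := by
      cases y i <;> cases y j <;> norm_num [deepWellLyapunov]
    have := pow_nonneg (sub_nonneg.2 hr1) T
    nlinarith
  have hdeepT : 14 / 15 ≤ (μ ᵥ* P ^ T) ⬝ᵥ g := by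
    have hfg (y) : (fun _ => (1 : ℝ)) y ≤ (g + (1 / 3 : ℝ) • f) y := by
      simp only [hg, hf, Pi.add_apply, Pi.smul_apply, smul_eq_mul]
      cases y i <;> cases y j <;> norm_num [deepWellLyapunov]
    have hgT (y) : 14 / 15 ≤ (P ^ T *ᵥ g) y := by
      have hPT : ∀ z, 0 ≤ (P ^ T) y z := by
        intro z
        exact Matrix.pow_apply_nonneg hP.1 T y z
      have hle : (P ^ T *ᵥ fun _ => (1 : ℝ)) y ≤ (P ^ T *ᵥ (g + (1 / 3 : ℝ) • f)) y :=
        Finset.sum_le_sum fun z _ => mul_le_mul_of_nonneg_left (hfg z) (hPT z)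
      rw [hP.pow_mulVec_const, Matrix.mulVec_add, Matrix.mulVec_smul] at hle
      simp only [Pi.add_apply, Pi.smul_apply, smul_eq_mul] at hle
      linarith [hlow y]
    rw [← Matrix.dotProduct_mulVec]
    calc (14 / 15 : ℝ) = ∑ y, μ y * (14 / 15) := by rw [← Finset.sum_mul, hμ.2, one_mul]
      _ ≤ _ := Finset.sum_le_sum fun y _ => mul_le_mul_of_nonneg_left (hgT y) (hμ.1 y)
  have hdeep : 14 / 15 - ε ≤ μ ⬝ᵥ g := by
    have := dotProduct_sub_le_tvDist (hP.sum_vecMul_pow μ T) hg0 hg1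
    linarith [hmeta T le_rfl]
  have hstart : ((P ^ s) fun _ => false) ⬝ᵥ g ≤ 1 / 4 := by
    have hesc := hP.pow_mulVec_le_add escape s (fun _ => false)
    simp only [Bool.or_self, Bool.false_eq_true, if_false, zero_add] at hesc
    refine le_trans ?_ (hesc.trans hs)
    refine Finset.sum_le_sum fun z _ =>
      mul_le_mul_of_nonneg_left ?_ (Matrix.pow_apply_nonneg hP.1 s _ z)
    simp only [hg]
    cases z i <;> cases z j <;> norm_num
  have hfin := dotProduct_sub_le_tvDist
    (hμ.2.trans (hP.sum_pow_apply s fun _ => false).symm) hg0 hg1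
  rw [tvDist_comm]
  linarith

end DoubleWell

/-- There is a family of `n`-player two-strategy potential games whose logit dynamics is
not asymptotically metastable. -/
theorem not_asymptotically_metastable :
    ∀ ε : ℝ, 0 < ε → ε < 1 / 4 →
      ∃ β₀ : ℝ, 0 ≤ β₀ ∧
        ∀ β : ℝ, β₀ ≤ β →
          ∃ Φ : (n : ℕ) → (Fin n → Bool) → ℝ,
            ∀ n₀ : ℕ, ∀ p q : ℕ → ℝ, PolyGrowth p → SuperPoly q →
              ∃ n : ℕ, n₀ ≤ n ∧ 1 ≤ n ∧
                ∃ x : Fin n → Bool,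
                  ∀ μ : (Fin n → Bool) → ℝ, IsProbDist μ →
                    IsMetastable (logitPpot n (fun _ => Bool) (Φ n) β) μ ε ⌈q n⌉₊ →
                      ∀ t : ℕ, (t : ℝ) ≤ p n →
                        ε < tvDist (((logitPpot n (fun _ => Bool) (Φ n) β) ^ t) x) μ := by
  intro ε _ hε
  refine ⟨1, zero_le_one, fun β hβ => ?_⟩
  -- The barrier is `n ^ k` with an exponent `k` that takes every value infinitely often.
  refine ⟨fun n => if hn : 2 ≤ n then
    doubleWellPotential ⟨0, by omega⟩ ⟨1, by omega⟩ β ((n : ℝ) ^ (Nat.unpair n).1)⁻¹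
    else 0, fun n₀ p q hp hq => ?_⟩
  obtain ⟨C, k, hC⟩ := hp
  obtain ⟨N, hN⟩ := Filter.eventually_atTop.1
    ((hq.2 (k + 1)).eventually (gt_mem_nhds (show (0 : ℝ) < 1 / 160 by norm_num)))
  obtain ⟨M, hM⟩ := exists_nat_ge (8 * |C| * 2 ^ k)
  obtain ⟨n, hn0, hn2, hnN, hnM, hnk⟩ :
      ∃ n, n₀ ≤ n ∧ 2 ≤ n ∧ N ≤ n ∧ M ≤ n ∧ (Nat.unpair n).1 = k := by
    have := Nat.right_le_pair k (n₀ + 2 + N + M)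
    exact ⟨Nat.pair k (n₀ + 2 + N + M), by omega, by omega, by omega, by omega, by simp⟩
  refine ⟨n, hn0, by omega, fun _ => false, fun μ hμ hmeta t ht => ?_⟩
  simp only [dif_pos hn2, hnk] at hmeta ⊢
  have hnpos : (1 : ℝ) ≤ n := by exact_mod_cast (by omega : 1 ≤ n)
  have hn : (0 : ℝ) < n := by linarith
  refine doubleWell_far_from_metastable (by simp [Fin.ext_iff]) (by linarith) (by positivity)
    (inv_le_one_of_one_le₀ (one_le_pow₀ hnpos)) hε ?_ ?_ hμ hmeta
  · have ht' : (t : ℝ) ≤ |C| * (2 ^ k * (n : ℝ) ^ k) := by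
      refine ht.trans ((hC n).2.trans ?_)
      rw [← mul_pow]
      gcongr
      · exact le_abs_self C
      · linarith
    have hnM' : 8 * |C| * 2 ^ k ≤ (n : ℝ) := hM.trans (by exact_mod_cast hnM)
    rw [show (t : ℝ) * (2 * ((n : ℝ) ^ k)⁻¹ / n) = 2 * t / ((n : ℝ) ^ k * n) by field_simp,
      div_le_iff₀ (by positivity)]
    have := mul_le_mul_of_nonneg_right hnM' (pow_nonneg hn.le k)
    linarith
  · have hq' := (hN n hnN)
    rw [div_lt_iff₀ (hq.1 n)] at hq'
    have hceil := Nat.le_ceil (q n)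
    rw [show (⌈q n⌉₊ : ℝ) * (((n : ℝ) ^ k)⁻¹ / (4 * n)) = ⌈q n⌉₊ / (4 * (n : ℝ) ^ (k + 1)) by
      rw [pow_succ]; field_simp, le_div_iff₀ (by positivity)]
    linarith
end

section
/- Let P be the logit dynamics transition matrix of an n-player game at rationality level β ≥ 0, on profile space S, where n ≥ 1 and every player's strategy set S_i has at least two elements. Then the determinant of P is 0. -/
open Finset Matrix

/-- The logit update probabilities of player `i` do not depend on the strategy of player `i`. -/
theorem logitσ_update {n : ℕ} {Sty : Fin n → Type*} [∀ i, Fintype (Sty i)]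
    [∀ i, DecidableEq (Sty i)]
    (u : ∀ i : Fin n, (∀ j, Sty j) → ℝ) (β : ℝ) (i : Fin n)
    (x : ∀ j, Sty j) (s t : Sty i) :
    logitσ u β i (Function.update x i s) t = logitσ u β i x t := by
  simp [logitσ]

/-- The logit dynamics matrix is the average over the players of the single-player
update matrices. -/
theorem logitP_apply (n : ℕ) (Sty : Fin n → Type*) [∀ i, Fintype (Sty i)]
    [∀ i, DecidableEq (Sty i)]
    (u : ∀ i : Fin n, (∀ j, Sty j) → ℝ) (β : ℝ) (x y : ∀ j, Sty j) :
    logitP n Sty u β x y =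
      (n : ℝ)⁻¹ * ∑ i, if Function.update y i (x i) = x then logitσ u β i x (y i) else 0 := by
  have key : ∀ i, Function.update y i (x i) = x ↔ ∀ j, x j ≠ y j → j = i := by
    intro i
    rw [Function.update_eq_iff]
    simp only [true_and]
    exact ⟨fun h j hj => by_contra fun hji => hj (h j hji).symm,
      fun h j hji => by_contra fun hj => hji (h j (Ne.symm hj))⟩
  unfold logitP
  split_ifs with hxy hcard
  · subst hxy
    simp
  · obtain ⟨i, hi⟩ := Finset.card_eq_one.mp hcard
    have hmem : ∀ j, x j ≠ y j ↔ j = i := by simpa [Finset.ext_iff] using hi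
    rw [← Finset.sum_filter]
    congr 2
    ext j
    simp only [Finset.mem_filter, Finset.mem_univ, true_and, key, hmem, forall_eq]
    exact eq_comm
  · rw [Finset.sum_eq_zero, mul_zero]
    intro i _
    refine if_neg fun h => hcard (Finset.card_eq_one.mpr ⟨i, ?_⟩)
    obtain ⟨j, hj⟩ := Function.ne_iff.mp hxy
    have hji := (key i).mp h j hj
    subst hji
    ext k
    simp only [Finset.mem_filter, Finset.mem_univ, true_and, Finset.mem_singleton]
    exact ⟨(key j).mp h k, fun hk => hk ▸ hj⟩

/-- Summing over the profiles that agree with `y` off coordinate `i` amounts to summing over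
the strategies of player `i`. -/
theorem sum_ite_update_eq {ι : Type*} [Fintype ι] [DecidableEq ι] {α : ι → Type*}
    [∀ i, Fintype (α i)] [∀ i, DecidableEq (α i)] {M : Type*} [AddCommMonoid M]
    (y : ∀ j, α j) (i : ι) (F : (∀ j, α j) → M) :
    (∑ x, if Function.update y i (x i) = x then F x else 0) =
      ∑ s, F (Function.update y i s) := by
  rw [← Finset.sum_filter]
  refine Finset.sum_bij' (fun x _ => x i) (fun s _ => Function.update y i s) ?_ ?_ ?_ ?_ ?_
  · simp
  · simp
  · intro x hx
    exact (Finset.mem_filter.mp hx).2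
  · simp
  · intro x hx
    rw [(Finset.mem_filter.mp hx).2]

/-- A product of functions of the individual strategies, each summing to zero, is a left null
vector of the logit dynamics matrix. -/
theorem prod_vecMul_logitP (n : ℕ) (Sty : Fin n → Type*) [∀ i, Fintype (Sty i)]
    [∀ i, DecidableEq (Sty i)]
    (u : ∀ i : Fin n, (∀ j, Sty j) → ℝ) (β : ℝ)
    (g : ∀ i, Sty i → ℝ) (hg : ∀ i, ∑ s, g i s = 0) :
    (fun x => ∏ j, g j (x j)) ᵥ* logitP n Sty u β = 0 := by
  ext y
  simp only [Matrix.vecMul, dotProduct, logitP_apply, Pi.zero_apply]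
  simp_rw [mul_left_comm _ (n : ℝ)⁻¹, ← Finset.mul_sum]
  refine mul_eq_zero_of_right _ ?_
  simp_rw [Finset.mul_sum]
  rw [Finset.sum_comm]
  refine Finset.sum_eq_zero fun i _ => ?_
  simp_rw [mul_ite, mul_zero]
  rw [sum_ite_update_eq y i fun x => (∏ j, g j (x j)) * logitσ u β i x (y i)]
  simp_rw [logitσ_update]
  rw [← Finset.sum_mul]
  have hprod : ∀ s, ∏ j, g j (Function.update y i s j) =
      g i s * ∏ j ∈ Finset.univ.erase i, g j (y j) := by
    intro s
    rw [← Finset.mul_prod_erase _ _ (Finset.mem_univ i), Function.update_self]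
    congr 1
    refine Finset.prod_congr rfl fun j hj => ?_
    rw [Function.update_of_ne (Finset.ne_of_mem_erase hj)]
  simp_rw [hprod]
  rw [← Finset.sum_mul, hg, zero_mul, zero_mul]

/-- The determinant of the logit dynamics transition matrix is `0` (when every player has
at least two strategies). -/
theorem logitP_det_eq_zero (n : ℕ) (hn : 1 ≤ n)
    (Sty : Fin n → Type*) [∀ i, Fintype (Sty i)] [∀ i, DecidableEq (Sty i)]
    [∀ i, Nonempty (Sty i)]
    (hcard : ∀ i, 1 < Fintype.card (Sty i))
    (u : ∀ i : Fin n, (∀ j, Sty j) → ℝ) (β : ℝ) (hβ : 0 ≤ β) :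
    (logitP n Sty u β).det = 0 := by
  choose a b hab using fun i => Fintype.exists_pair_of_one_lt_card (hcard i)
  refine Matrix.exists_vecMul_eq_zero_iff.mp ⟨_, ?_, prod_vecMul_logitP n Sty u β
    (fun i => Pi.single (a i) 1 - Pi.single (b i) 1) fun i => ?_⟩
  · exact Function.ne_iff.mpr ⟨a, by simp [hab]⟩
  · simp
end

section
/- Let G be an n-player game (n ≥ 1) with finite nonempty strategy sets S_1, …, S_n, profile space S, and utilities u_i, and suppose G is an exact potential game with potential Φ : S → ℝ, i.e., Φ(x) − Φ(x_{−i}, s) = u_i(x_{−i}, s) − u_i(x) for every profile x, every player i, and every strategy s ∈ S_i. Let P be the logit dynamics transition matrix of G at rationality level β ≥ 0, and let π be the Gibbs measure π(x) = exp(−β·Φ(x))/Z with Z = Σ_{y∈S} exp(−β·Φ(y)). Then P is reversible with respect to π: π(x)·P(x,y) = π(y)·P(y,x) for all x, y ∈ S (in particular π is a stationary distribution of P). -/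
open Finset Matrix

/-- Detailed balance along a single-player deviation: if `x` and `y` differ at most in the
coordinate `i`, the logit updates between them are balanced by the Gibbs weights. -/
theorem gibbs_mul_logitσ_comm {n : ℕ} {Sty : Fin n → Type*} [∀ i, Fintype (Sty i)]
    [∀ i, DecidableEq (Sty i)]
    (u : ∀ i : Fin n, (∀ j, Sty j) → ℝ) (Φ : (∀ j, Sty j) → ℝ)
    (hpot : ∀ (x : ∀ j, Sty j) (i : Fin n) (s : Sty i),
      Φ x - Φ (Function.update x i s) = u i (Function.update x i s) - u i x)
    (β : ℝ) {x y : ∀ j, Sty j} {i : Fin n} (hxy : ∀ j, j ≠ i → x j = y j) :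
    gibbs β Φ x * logitσ u β i x (y i) = gibbs β Φ y * logitσ u β i y (x i) := by
  have hupd (z : Sty i) : Function.update x i z = Function.update y i z := by
    ext j
    by_cases hj : j = i
    · subst hj; simp
    · simp [hj, hxy j hj]
  have hy : Function.update x i (y i) = y := by rw [hupd, Function.update_eq_self]
  have hx : Function.update y i (x i) = x := by rw [← hupd, Function.update_eq_self]
  have hΦ : Φ x - Φ y = u i y - u i x := by simpa only [hy] using hpot x i (y i)
  have hexp : Real.exp (-β * Φ x) * Real.exp (β * u i y)
      = Real.exp (-β * Φ y) * Real.exp (β * u i x) := by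
    rw [← Real.exp_add, ← Real.exp_add]
    congr 1
    linear_combination (-β) * hΦ
  simp only [gibbs, logitσ, hy, hx, hupd]
  rw [div_mul_div_comm, div_mul_div_comm, hexp]

/-- For an exact potential game, the logit dynamics transition matrix is reversible with
respect to the Gibbs measure. -/
theorem logitP_reversible_gibbs (n : ℕ) (hn : 1 ≤ n)
    (Sty : Fin n → Type*) [∀ i, Fintype (Sty i)] [∀ i, DecidableEq (Sty i)]
    [∀ i, Nonempty (Sty i)]
    (u : ∀ i : Fin n, (∀ j, Sty j) → ℝ) (Φ : (∀ j, Sty j) → ℝ)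
    (hpot : ∀ (x : ∀ j, Sty j) (i : Fin n) (s : Sty i),
      Φ x - Φ (Function.update x i s) = u i (Function.update x i s) - u i x)
    (β : ℝ) (hβ : 0 ≤ β) :
    Reversible (logitP n Sty u β) (gibbs β Φ) := by
  intro x y
  by_cases hxy : x = y
  · rw [hxy]
  have hfilter : (Finset.univ.filter fun i => y i ≠ x i)
      = Finset.univ.filter fun i => x i ≠ y i := by
    simp only [ne_comm]
  simp only [logitP, if_neg hxy, if_neg (Ne.symm hxy), hfilter]
  split_ifs with hcard
  · obtain ⟨i, hi⟩ := Finset.card_eq_one.mp hcard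
    have hagree : ∀ j, j ≠ i → x j = y j := by
      intro j hj
      by_contra hne
      have hmem : j ∈ Finset.univ.filter fun k => x k ≠ y k := by simpa using hne
      rw [hi, Finset.mem_singleton] at hmem
      exact hj hmem
    rw [hi, Finset.sum_singleton, Finset.sum_singleton, mul_left_comm,
      gibbs_mul_logitσ_comm u Φ hpot β hagree, mul_left_comm]
  · simp
end

section
/- Let P be a stochastic matrix on a finite set S and let π be a probability distribution on S that is stationary for P (i.e., π·P = π). Let L ⊆ S be nonempty with π(L) > 0 and let π_L be the conditional distribution. Then π_L is (B(L), 1)-metastable for P; in particular ‖π_L·P − π_L‖_TV ≤ B(L). -/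
open Finset Matrix

/-- If `μ` and `ν` have the same mass, `ν ≤ μ` on `L` and `μ ≤ ν` off `L`, then their total
variation distance is the mass that `ν` has in excess of `μ` off `L`. -/
theorem tvDist_eq_sum_compl {S : Type*} [Fintype S] [DecidableEq S] {μ ν : S → ℝ} {L : Finset S}
    (hmass : ∑ x, ν x = ∑ x, μ x) (hle : ∀ x ∈ L, ν x ≤ μ x) (hge : ∀ x ∉ L, μ x ≤ ν x) :
    tvDist ν μ = ∑ x ∈ Lᶜ, (ν x - μ x) := by
  have h₁ : ∑ x ∈ L, |ν x - μ x| = ∑ x ∈ L, -(ν x - μ x) :=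
    sum_congr rfl fun x hx => abs_of_nonpos (sub_nonpos.2 (hle x hx))
  have h₂ : ∑ x ∈ Lᶜ, |ν x - μ x| = ∑ x ∈ Lᶜ, (ν x - μ x) :=
    sum_congr rfl fun x hx => abs_of_nonneg (sub_nonneg.2 (hge x (mem_compl.1 hx)))
  have h₃ : ∑ x, (ν x - μ x) = 0 := by rw [sum_sub_distrib, hmass, sub_self]
  rw [← sum_add_sum_compl L] at h₃
  rw [tvDist, ← sum_add_sum_compl L, h₁, h₂, sum_neg_distrib]
  linarith

/-- A stochastic matrix preserves the total mass of a row vector. -/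
theorem IsStochastic.sum_vecMul {S : Type*} [Fintype S] {P : Matrix S S ℝ} (hP : IsStochastic P)
    (μ : S → ℝ) : ∑ y, (μ ᵥ* P) y = ∑ x, μ x := by
  simp only [vecMul, dotProduct]
  rw [sum_comm]
  simp only [← mul_sum, hP.2, mul_one]

/-- One step of the chain moves the conditional stationary distribution on `L` by exactly the
bottleneck ratio of `L`. -/
theorem tvDist_vecMul_cond_eq_bottleneck {S : Type*} [Fintype S] [DecidableEq S]
    {P : Matrix S S ℝ} (hP : IsStochastic P) {π : S → ℝ} (hπ : ∀ x, 0 ≤ π x)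
    (hstat : π ᵥ* P = π) (L : Finset S) :
    tvDist ((fun x => if x ∈ L then π x / ∑ z ∈ L, π z else 0) ᵥ* P)
      (fun x => if x ∈ L then π x / ∑ z ∈ L, π z else 0) = bottleneck P π L := by
  have hm : 0 ≤ ∑ z ∈ L, π z := sum_nonneg fun z _ => hπ z
  have hstep (y : S) : ((fun x => if x ∈ L then π x / ∑ z ∈ L, π z else 0) ᵥ* P) y =
      (∑ x ∈ L, π x * P x y) / ∑ z ∈ L, π z := by
    simp [vecMul, dotProduct, ite_mul, sum_ite_mem, sum_div, div_mul_eq_mul_div]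
  rw [tvDist_eq_sum_compl (L := L) (hP.sum_vecMul _)]
  · rw [bottleneck, sum_comm, sum_div]
    refine sum_congr rfl fun y hy => ?_
    rw [hstep, if_neg (mem_compl.1 hy), sub_zero]
  · intro y hy
    rw [hstep, if_pos hy]
    gcongr
    calc ∑ x ∈ L, π x * P x y ≤ ∑ x, π x * P x y :=
          sum_le_univ_sum_of_nonneg fun x => mul_nonneg (hπ x) (hP.1 x y)
      _ = π y := congrFun hstat y
  · intro y hy
    rw [hstep, if_neg hy]
    exact div_nonneg (sum_nonneg fun x _ => mul_nonneg (hπ x) (hP.1 x y)) hm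

/-- The conditional stationary distribution `π_L` is `(B(L), 1)`-metastable; in particular
`‖π_L·P − π_L‖_TV ≤ B(L)`. -/
theorem piL_metastable {S : Type*} [Fintype S] [DecidableEq S]
    (P : Matrix S S ℝ) (hP : IsStochastic P)
    (π : S → ℝ) (hπ : IsProbDist π) (hstat : π ᵥ* P = π)
    (L : Finset S) (hL : L.Nonempty) (hπL : 0 < ∑ z ∈ L, π z) :
    IsMetastable P (fun x => if x ∈ L then π x / ∑ z ∈ L, π z else 0)
        (bottleneck P π L) 1 ∧
      tvDist ((fun x => if x ∈ L then π x / ∑ z ∈ L, π z else 0) ᵥ* P)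
          (fun x => if x ∈ L then π x / ∑ z ∈ L, π z else 0)
        ≤ bottleneck P π L := by
  have hone := (tvDist_vecMul_cond_eq_bottleneck hP hπ.1 hstat L).le
  refine ⟨fun t ht => ?_, hone⟩
  interval_cases t
  · have hB : 0 ≤ bottleneck P π L := div_nonneg
      (sum_nonneg fun x _ => sum_nonneg fun y _ => mul_nonneg (hπ.1 x) (hP.1 x y)) hπL.le
    simpa [tvDist] using hB
  · simpa only [pow_one] using hone
end
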